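/- arXiv:1403.5726 — 10 statements merged into one kernel-verified Lean document; each statement's English description precedes it below -/
import Mathlib

section
/- Let A be a quandle, let R be a congruence on A, and let N be a normal subgroup of Inn(A). Then the congruence ∼_N permutes with R in the sense of relational composition: ∼_N ∘ R = R ∘ ∼_N, where S ∘ R = {(a,b) : ∃ c, (a,c) ∈ R and (c,b) ∈ S}. -/
/- Conventions: we use Mathlib's `Quandle`, in which the translation by `b` is
`Rack.act' b : a ↦ b ◃ a` (the mirror of the paper's right-action convention
`ρ_b : a ↦ a ◃ b`).  Accordingly, a *trivial* quandle is one with `x ◃ y = y`. -/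

open Quandles

/-- The subgroup `Inn(A)` of inner automorphisms of a quandle `A`: the subgroup of the
permutation group of `A` generated by the translations. -/
def Inn (A : Type*) [Quandle A] : Subgroup (Equiv.Perm A) :=
  Subgroup.closure (Set.range fun b : A => (Rack.act' b : Equiv.Perm A))

/-- A quandle homomorphism: a map preserving `◃` (and hence `◃⁻¹`). -/
def IsQndHom {A B : Type*} [Quandle A] [Quandle B] (f : A → B) : Prop :=
  ∀ a a' : A, f (a ◃ a') = f a ◃ f a'

/-- A congruence on a quandle: an equivalence relation compatible with `◃` and `◃⁻¹`. -/
def IsQndCongr {A : Type*} [Quandle A] (R : A → A → Prop) : Prop :=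
  Equivalence R ∧
    (∀ a b a' b' : A, R a b → R a' b' → R (a ◃ a') (b ◃ b')) ∧
    (∀ a b a' b' : A, R a b → R a' b' → R (a ◃⁻¹ a') (b ◃⁻¹ b'))

/-- The component relation (connectedness) setoid of a quandle: `a ≈ b` iff some inner
automorphism sends `a` to `b`.  Its quotient is `π₀(A)`. -/
def compSetoid (A : Type*) [Quandle A] : Setoid A where
  r a b := ∃ φ ∈ Inn A, φ a = b
  iseqv := by
    constructor
    · exact fun a => ⟨1, one_mem _, rfl⟩
    · rintro a b ⟨φ, hφ, rfl⟩
      exact ⟨φ⁻¹, inv_mem hφ, by simp⟩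
    · rintro a b c ⟨φ, hφ, rfl⟩ ⟨ψ, hψ, rfl⟩
      exact ⟨ψ * φ, mul_mem hψ hφ, by simp⟩

/-- Inner automorphisms preserve congruences. -/
theorem Inn_preserves {A : Type*} [Quandle A] (R : A → A → Prop) (hR : IsQndCongr R)
    (φ : Equiv.Perm A) (hφ : φ ∈ Inn A) : ∀ x y : A, R x y → R (φ x) (φ y) := by
  obtain ⟨he, h1, h2⟩ := hR
  refine Subgroup.closure_induction'' (p := fun φ _ => ∀ x y : A, R x y → R (φ x) (φ y))
    ?_ ?_ ?_ ?_ hφ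
  · rintro _ ⟨b, rfl⟩ x y h
    exact h1 b b x y (he.refl b) h
  · rintro _ ⟨b, rfl⟩ x y h
    exact h2 b b x y (he.refl b) h
  · intro x y h
    exact h
  · intro f g _ _ hf hg x y h
    exact hf _ _ (hg _ _ h)

/-- The congruence `∼_N` associated with a normal subgroup `N` of `Inn(A)` permutes with any
congruence `R` on `A` in the sense of relational composition. -/
theorem stmt0 {A : Type*} [Quandle A] (R : A → A → Prop) (hR : IsQndCongr R)
    (N : Subgroup ↥(Inn A)) (hN : N.Normal) :
    ∀ a b : A,
      (∃ c : A, R a c ∧ ∃ n ∈ N, (n : Equiv.Perm A) c = b) ↔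
        (∃ c : A, (∃ n ∈ N, (n : Equiv.Perm A) a = c) ∧ R c b) := by
  intro a b
  constructor
  · rintro ⟨c, hac, n, hn, rfl⟩
    exact ⟨_, ⟨n, hn, rfl⟩, Inn_preserves R hR n n.2 _ _ hac⟩
  · rintro ⟨c, ⟨n, hn, rfl⟩, hcb⟩
    refine ⟨(n : Equiv.Perm A)⁻¹ b, ?_, n, hn, by simp⟩
    have := Inn_preserves R hR (n : Equiv.Perm A)⁻¹ (inv_mem n.2) _ _ hcb
    simpa using this
end

section
/- Let f : A → B and g : A → C be surjective quandle homomorphisms and let f̄ : C → D and ḡ : B → D be quandle homomorphisms with ḡ ∘ f = f̄ ∘ g. Assume that Eq(f) = ∼_{Ker(Inn(f))}, and that Eq(f̄ ∘ g) is the smallest congruence on A containing both Eq(f) and Eq(g). Then the induced map (g,f) : A → C ×_D B to the pullback is surjective; that is, for all b ∈ B and c ∈ C with ḡ(b) = f̄(c) there exists a ∈ A with f(a) = b and g(a) = c. -/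
/- Conventions: we use Mathlib's `Quandle`, in which the translation by `b` is
`Rack.act' b : a ↦ b ◃ a` (the mirror of the paper's right-action convention
`ρ_b : a ↦ a ◃ b`).  Accordingly, a *trivial* quandle is one with `x ◃ y = y`. -/

open Quandles

theorem IsQndHom.map_invAct {A B : Type*} [Quandle A] [Quandle B] {f : A → B}
    (hf : IsQndHom f) (a a' : A) : f (a ◃⁻¹ a') = f a ◃⁻¹ f a' := by
  rw [← Rack.left_cancel (f a), ← hf, Rack.act_invAct_eq, Rack.act_invAct_eq]

/-- The kernel pair of a homomorphism is stable under inner automorphisms. -/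
theorem IsQndHom.inn_congr {A C : Type*} [Quandle A] [Quandle C] {g : A → C}
    (hg : IsQndHom g) {φ : Equiv.Perm A} (hφ : φ ∈ Inn A) :
    ∀ x y : A, g x = g y ↔ g (φ x) = g (φ y) := by
  unfold Inn at hφ
  induction hφ using Subgroup.closure_induction with
  | mem φ h =>
    obtain ⟨b, rfl⟩ := h
    intro x y
    simp only [Rack.act'_apply]
    rw [hg, hg, Rack.left_cancel]
  | one => intro x y; rfl
  | mul φ ψ _ _ h1 h2 =>
    intro x y
    rw [h2, h1]; rfl
  | inv φ _ h =>
    intro x y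
    rw [h (φ⁻¹ x)]; simp

/-- In a pushout-style square of surjective quandle homomorphisms where
`Eq(f) = ∼_{Ker(Inn(f))}` and `Eq(f̄ ∘ g)` is the smallest congruence containing `Eq(f)` and
`Eq(g)`, the induced map `(g, f) : A → C ×_D B` to the pullback is surjective. -/
theorem stmt3 {A B C D : Type*} [Quandle A] [Quandle B] [Quandle C] [Quandle D]
    (f : A → B) (g : A → C) (fbar : C → D) (gbar : B → D)
    (hfs : Function.Surjective f) (hgs : Function.Surjective g)
    (hfh : IsQndHom f) (hgh : IsQndHom g) (hfbarh : IsQndHom fbar) (hgbarh : IsQndHom gbar)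
    (hcomm : ∀ a : A, gbar (f a) = fbar (g a))
    (F : ↥(Inn A) →* ↥(Inn B))
    (hF : ∀ (φ : ↥(Inn A)) (a : A), (F φ : Equiv.Perm B) (f a) = f ((φ : Equiv.Perm A) a))
    (hEf : ∀ a a' : A, f a = f a' ↔ ∃ n ∈ F.ker, (n : Equiv.Perm A) a = a')
    (hcong : IsQndCongr fun a a' : A => fbar (g a) = fbar (g a'))
    (hsubf : ∀ a a' : A, f a = f a' → fbar (g a) = fbar (g a'))
    (hsubg : ∀ a a' : A, g a = g a' → fbar (g a) = fbar (g a'))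
    (hsmall : ∀ T : A → A → Prop, IsQndCongr T →
      (∀ a a' : A, f a = f a' → T a a') → (∀ a a' : A, g a = g a' → T a a') →
      ∀ a a' : A, fbar (g a) = fbar (g a') → T a a') :
    ∀ (b : B) (c : C), gbar b = fbar c → ∃ a : A, f a = b ∧ g a = c := by
  have hT : IsQndCongr fun a a' : A => ∃ m, f a = f m ∧ g m = g a' := by
    refine ⟨⟨fun a => ⟨a, rfl, rfl⟩, ?_, ?_⟩, ?_, ?_⟩
    · rintro a a' ⟨m, h1, h2⟩
      obtain ⟨n, hn, rfl⟩ := (hEf _ _).1 h1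
      refine ⟨((n⁻¹ : Inn A) : Equiv.Perm A) a', (hEf _ _).2 ⟨n⁻¹, inv_mem hn, rfl⟩, ?_⟩
      rw [hgh.inn_congr n.2]
      simpa using h2.symm
    · rintro a b c ⟨m, h1, h2⟩ ⟨m', h3, h4⟩
      obtain ⟨n, hn, rfl⟩ := (hEf _ _).1 h3
      refine ⟨(n : Equiv.Perm A) m, h1.trans ((hEf _ _).2 ⟨n, hn, rfl⟩), ?_⟩
      rw [← h4]
      exact (hgh.inn_congr n.2 _ _).1 h2
    · rintro a b a' b' ⟨m, h1, h2⟩ ⟨m', h3, h4⟩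
      exact ⟨m ◃ m', by rw [hfh, hfh, h1, h3], by rw [hgh, hgh, h2, h4]⟩
    · rintro a b a' b' ⟨m, h1, h2⟩ ⟨m', h3, h4⟩
      exact ⟨m ◃⁻¹ m', by rw [hfh.map_invAct, hfh.map_invAct, h1, h3],
        by rw [hgh.map_invAct, hgh.map_invAct, h2, h4]⟩
  intro b c hbc
  obtain ⟨a, rfl⟩ := hfs b
  obtain ⟨a', rfl⟩ := hgs c
  rw [hcomm] at hbc
  obtain ⟨m, h1, h2⟩ := hsmall _ hT (fun a a' h => ⟨a', h, rfl⟩) (fun a a' h => ⟨a, rfl, h⟩) a a' hbc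
  exact ⟨m, h1.symm, h2⟩
end

section
/- Let f : A → B be a surjective quandle homomorphism. Then the canonical map (η_A, f) : A → π₀(A) ×_{π₀(B)} B is surjective; that is, for every a' ∈ A and b ∈ B with π₀(f)([a']) = [b] (i.e. f(a') ≈_B b), there exists a ∈ A with a ≈_A a' and f(a) = b. -/
/- Conventions: we use Mathlib's `Quandle`, in which the translation by `b` is
`Rack.act' b : a ↦ b ◃ a` (the mirror of the paper's right-action convention
`ρ_b : a ↦ a ◃ b`).  Accordingly, a *trivial* quandle is one with `x ◃ y = y`. -/

open Quandles

/-- For a surjective quandle homomorphism `f : A → B`, the canonical map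
`(η_A, f) : A → π₀(A) ×_{π₀(B)} B` is surjective. -/
theorem stmt4 {A B : Type*} [Quandle A] [Quandle B] (f : A → B)
    (hf : Function.Surjective f) (hhom : IsQndHom f) :
    ∀ (a' : A) (b : B), (∃ ψ ∈ Inn B, ψ (f a') = b) →
      ∃ a : A, (∃ φ ∈ Inn A, φ a = a') ∧ f a = b := by
  have key : ∀ ψ ∈ Inn B, ∃ φ ∈ Inn A, ∀ a, f (φ a) = ψ (f a) := by
    intro ψ hψ
    unfold Inn at hψ
    induction hψ using Subgroup.closure_induction with
    | mem x hx =>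
      obtain ⟨b, rfl⟩ := hx
      obtain ⟨c, rfl⟩ := hf b
      exact ⟨Rack.act' c, Subgroup.subset_closure ⟨c, rfl⟩, fun a => hhom c a⟩
    | one => exact ⟨1, one_mem _, fun a => rfl⟩
    | mul x y _ _ hx hy =>
      obtain ⟨p, hp, hp'⟩ := hx
      obtain ⟨q, hq, hq'⟩ := hy
      exact ⟨p * q, mul_mem hp hq, fun a => by
        rw [Equiv.Perm.mul_apply, Equiv.Perm.mul_apply, hp', hq']⟩
    | inv x _ hx =>
      obtain ⟨p, hp, hp'⟩ := hx
      refine ⟨p⁻¹, inv_mem hp, fun a => ?_⟩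
      rw [Equiv.Perm.eq_inv_iff_eq, ← hp']; simp
  rintro a' b ⟨ψ, hψ, rfl⟩
  obtain ⟨φ, hφ, h⟩ := key ψ hψ
  exact ⟨φ a', ⟨φ⁻¹, inv_mem hφ, by simp⟩, h a'⟩
end

section
/- Let B be a quandle, let X be a trivial quandle (x ◃ y = x for all x, y), and let φ : X → π₀(B) be a surjective quandle homomorphism. Let P = {(b,x) ∈ B × X : [b] = φ(x)} be the pullback, a subquandle of B × X with componentwise operations. Then the map π₀(P) → X sending the component [(b,x)] to x is well defined and bijective; that is, the reflector π₀ preserves this pullback. -/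
/- Conventions: we use Mathlib's `Quandle`, in which the translation by `b` is
`Rack.act' b : a ↦ b ◃ a` (the mirror of the paper's right-action convention
`ρ_b : a ↦ a ◃ b`).  Accordingly, a *trivial* quandle is one with `x ◃ y = y`. -/

open Quandles

/-- The fibre-product quandle structure on the pullback. -/
@[reducible] def pullbackQuandle {B X : Type*} [Quandle B] [Quandle X]
    (htriv : ∀ x y : X, x ◃ y = y) (φ : X → Quotient (compSetoid B)) :
    Quandle {p : B × X // Quotient.mk (compSetoid B) p.1 = φ p.2} where
  act p q := ⟨(p.val.1 ◃ q.val.1, p.val.2 ◃ q.val.2), by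
    simp only [htriv]
    rw [← q.2]
    refine Quotient.sound ((compSetoid B).symm ?_)
    exact ⟨Rack.act' p.val.1, Subgroup.subset_closure ⟨_, rfl⟩, rfl⟩⟩
  self_distrib := by
    intro x y z
    exact Subtype.ext (Prod.ext Shelf.self_distrib Shelf.self_distrib)
  invAct p q := ⟨(p.val.1 ◃⁻¹ q.val.1, p.val.2 ◃⁻¹ q.val.2), by
    have h : p.val.2 ◃⁻¹ q.val.2 = q.val.2 := by
      rw [← Rack.left_cancel p.val.2, Rack.act_invAct_eq, htriv]
    simp only [h]
    rw [← q.2]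
    refine Quotient.sound ?_
    exact ⟨Rack.act' p.val.1, Subgroup.subset_closure ⟨_, rfl⟩, Rack.act_invAct_eq _ _⟩⟩
  left_inv := fun x y => Subtype.ext (Prod.ext (Rack.invAct_act_eq _ _) (Rack.invAct_act_eq _ _))
  right_inv := fun x y => Subtype.ext (Prod.ext (Rack.act_invAct_eq _ _) (Rack.act_invAct_eq _ _))
  fix := Subtype.ext (Prod.ext Quandle.fix Quandle.fix)

/-- `π₀` preserves the pullback of a surjective map `φ : X → π₀(B)` from a trivial quandle
`X` along `η_B : B → π₀(B)`: the pullback `P = {(b,x) : [b] = φ x}` is a subquandle of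
`B × X`, and the map `π₀(P) → X`, `[(b,x)] ↦ x`, is well defined and bijective. -/
theorem stmt6 {B X : Type*} [Quandle B] [Quandle X]
    (htriv : ∀ x y : X, x ◃ y = y)
    (φ : X → Quotient (compSetoid B)) (hφ : Function.Surjective φ) :
    ∃ qP : Quandle {p : B × X // Quotient.mk (compSetoid B) p.1 = φ p.2},
      (∀ p q : {p : B × X // Quotient.mk (compSetoid B) p.1 = φ p.2},
          (p ◃ q).val = (p.val.1 ◃ q.val.1, p.val.2 ◃ q.val.2) ∧
          (p ◃⁻¹ q).val = (p.val.1 ◃⁻¹ q.val.1, p.val.2 ◃⁻¹ q.val.2)) ∧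
      ∃ e : Quotient (compSetoid {p : B × X // Quotient.mk (compSetoid B) p.1 = φ p.2}) → X,
        (∀ p : {p : B × X // Quotient.mk (compSetoid B) p.1 = φ p.2},
            e (Quotient.mk _ p) = p.val.2) ∧
        Function.Bijective e := by
  letI qP := pullbackQuandle htriv φ
  refine ⟨qP, fun p q => ⟨rfl, rfl⟩, ?_⟩
  have hinn : ∀ Ψ ∈ Inn {p : B × X // Quotient.mk (compSetoid B) p.1 = φ p.2},
      ∀ p, (Ψ p).val.2 = p.val.2 := by
    intro Ψ hΨ
    induction hΨ using Subgroup.closure_induction with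
    | mem y hy =>
      obtain ⟨b, rfl⟩ := hy
      intro p
      exact htriv _ _
    | one => intro p; rfl
    | mul f g _ _ hf hg =>
      intro p
      rw [Equiv.Perm.mul_apply, hf, hg]
    | inv f _ hf =>
      intro p
      rw [← hf (f⁻¹ p), show f (f⁻¹ p) = p from f.apply_symm_apply p]
  have hlift : ∀ ψ ∈ Inn B,
      ∃ Ψ ∈ Inn {p : B × X // Quotient.mk (compSetoid B) p.1 = φ p.2},
      ∀ p, (Ψ p).val.1 = ψ p.val.1 := by
    intro ψ hψ
    induction hψ using Subgroup.closure_induction with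
    | mem y hy =>
      obtain ⟨b, rfl⟩ := hy
      obtain ⟨x, hx⟩ := hφ (Quotient.mk _ b)
      exact ⟨Rack.act' ⟨(b, x), hx.symm⟩, Subgroup.subset_closure ⟨_, rfl⟩, fun p => rfl⟩
    | one => exact ⟨1, one_mem _, fun p => rfl⟩
    | mul f g _ _ hf hg =>
      obtain ⟨F, hF, hF'⟩ := hf
      obtain ⟨G, hG, hG'⟩ := hg
      refine ⟨F * G, mul_mem hF hG, fun p => ?_⟩
      rw [Equiv.Perm.mul_apply, hF', hG', Equiv.Perm.mul_apply]
    | inv f _ hf =>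
      obtain ⟨F, hF, hF'⟩ := hf
      refine ⟨F⁻¹, inv_mem hF, fun p => ?_⟩
      rw [Equiv.Perm.eq_inv_iff_eq, ← hF', show F (F⁻¹ p) = p from F.apply_symm_apply p]
  refine ⟨Quotient.lift (fun p => p.val.2) ?_, fun p => rfl, ?_, ?_⟩
  · rintro p q ⟨Ψ, hΨ, rfl⟩
    exact (hinn Ψ hΨ p).symm
  · intro p q
    induction p using Quotient.inductionOn with | _ p
    induction q using Quotient.inductionOn with | _ q
    intro h
    have h' : p.val.2 = q.val.2 := h
    have hb : Quotient.mk (compSetoid B) p.val.1 = Quotient.mk (compSetoid B) q.val.1 := by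
      rw [p.2, q.2, h']
    obtain ⟨ψ, hψ, hpq⟩ := Quotient.exact hb
    obtain ⟨Ψ, hΨ, hΨ'⟩ := hlift ψ hψ
    refine Quotient.sound ⟨Ψ, hΨ, Subtype.ext (Prod.ext ?_ ?_)⟩
    · rw [hΨ', hpq]
    · rw [hinn Ψ hΨ, h']
  · intro x
    obtain ⟨b, hb⟩ := Quotient.exists_rep (φ x)
    exact ⟨Quotient.mk _ ⟨(b, x), hb⟩, rfl⟩
end

section
/- There exist a finite quandle A, a trivial quandle B, and a surjective quandle homomorphism f : A → B admitting a section (a quandle homomorphism s : B → A with f ∘ s = id) such that the canonical map π₀(Eq(f)) → Eq(π₀(f)) induced by the two projections is not injective; hence the functor π₀ does not preserve kernel pairs of split epimorphisms. -/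
/- Conventions: we use Mathlib's `Quandle`, in which the translation by `b` is
`Rack.act' b : a ↦ b ◃ a` (the mirror of the paper's right-action convention
`ρ_b : a ↦ a ◃ b`).  Accordingly, a *trivial* quandle is one with `x ◃ y = y`. -/

open Quandles

/-- The four-element quandle in which `3` swaps `0` and `1`, and all else acts trivially. -/
def opA (x y : Fin 4) : Fin 4 := if x = 3 then Equiv.swap 0 1 y else y

@[reducible] def quandleA : Quandle (Fin 4) where
  act := opA
  self_distrib := by decide
  invAct := opA
  left_inv := by unfold Function.LeftInverse; decide
  right_inv := by unfold Function.RightInverse Function.LeftInverse; decide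
  fix := by decide

@[reducible] def quandleB : Quandle Bool where
  act := fun _ y => y
  self_distrib := by decide
  invAct := fun _ y => y
  left_inv := fun _ _ => rfl
  right_inv := fun _ _ => rfl
  fix := by decide

def mapF (x : Fin 4) : Bool := decide (x = 3)

def mapS (b : Bool) : Fin 4 := if b then 3 else 2

theorem mapF_opA : ∀ x y : Fin 4, mapF (opA x y) = mapF y := by decide

theorem opA_opA : ∀ x y : Fin 4, opA x (opA x y) = y := by decide

def opE (p q : {p : Fin 4 × Fin 4 // mapF p.1 = mapF p.2}) :
    {p : Fin 4 × Fin 4 // mapF p.1 = mapF p.2} :=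
  ⟨(opA p.val.1 q.val.1, opA p.val.2 q.val.2), by
    simp only [mapF_opA]; exact q.property⟩

theorem opE_opE (p q) : opE p (opE p q) = q :=
  Subtype.ext (Prod.ext (opA_opA _ _) (opA_opA _ _))

@[reducible] def quandleE : Quandle {p : Fin 4 × Fin 4 // mapF p.1 = mapF p.2} where
  act := opE
  self_distrib := fun {_ _ _} => Subtype.ext (Prod.ext
    (quandleA.self_distrib) (quandleA.self_distrib))
  invAct := opE
  left_inv := opE_opE
  right_inv := opE_opE
  fix := fun {_} => Subtype.ext (Prod.ext (quandleA.fix) (quandleA.fix))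

theorem opA_diag : ∀ x x' y y' : Fin 4, mapF x = mapF x' →
    (opA x y = opA x' y' ↔ y = y') := by decide

theorem inn_diag (φ : Equiv.Perm {p : Fin 4 × Fin 4 // mapF p.1 = mapF p.2})
    (hφ : φ ∈ @Inn _ quandleE) : ∀ p, (φ p).val.1 = (φ p).val.2 ↔ p.val.1 = p.val.2 := by
  unfold Inn at hφ
  induction hφ using Subgroup.closure_induction with
  | mem x hx =>
    obtain ⟨b, rfl⟩ := hx
    intro p
    exact opA_diag _ _ _ _ b.property
  | one => intro p; rfl
  | mul x y _ _ hx hy => intro p; exact (hx _).trans (hy _)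
  | inv x _ hx =>
    intro p
    have h := hx (x⁻¹ p)
    rw [show x (x⁻¹ p) = p from x.apply_symm_apply p] at h
    exact h.symm

/-- There is a finite quandle `A`, a trivial quandle `B` and a split surjective quandle
homomorphism `f : A → B` such that the canonical map `π₀(Eq(f)) → Eq(π₀(f))` is not
injective: `π₀` does not preserve kernel pairs of split epimorphisms. -/
theorem stmt7 :
    ∃ (A B : Type) (_ : Quandle A) (_ : Quandle B) (_ : Finite A),
      (∀ x y : B, x ◃ y = y) ∧
      ∃ (f : A → B) (s : B → A),
        IsQndHom f ∧ IsQndHom s ∧ Function.Surjective f ∧ (∀ b : B, f (s b) = b) ∧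
        ∃ qE : Quandle {p : A × A // f p.1 = f p.2},
          (∀ p q : {p : A × A // f p.1 = f p.2},
              (p ◃ q).val = (p.val.1 ◃ q.val.1, p.val.2 ◃ q.val.2) ∧
              (p ◃⁻¹ q).val = (p.val.1 ◃⁻¹ q.val.1, p.val.2 ◃⁻¹ q.val.2)) ∧
          ∃ p q : {p : A × A // f p.1 = f p.2},
            Quotient.mk (compSetoid A) p.val.1 = Quotient.mk (compSetoid A) q.val.1 ∧
            Quotient.mk (compSetoid A) p.val.2 = Quotient.mk (compSetoid A) q.val.2 ∧
            Quotient.mk (compSetoid {p : A × A // f p.1 = f p.2}) p ≠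
              Quotient.mk (compSetoid {p : A × A // f p.1 = f p.2}) q := by
  refine ⟨Fin 4, Bool, quandleA, quandleB, inferInstance, fun _ _ => rfl, mapF, mapS,
    mapF_opA, ?_, ?_, ?_, quandleE, fun _ _ => ⟨rfl, rfl⟩,
    ⟨(0, 0), rfl⟩, ⟨(0, 1), rfl⟩, rfl, ?_, ?_⟩
  · show ∀ a a' : Bool, mapS a' = opA (mapS a) (mapS a')
    decide
  · exact fun b => ⟨mapS b, by revert b; decide⟩
  · decide
  · letI := quandleA
    refine Quotient.sound ⟨Rack.act' (3 : Fin 4), Subgroup.subset_closure ⟨3, rfl⟩, ?_⟩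
    show opA 3 0 = 1
    decide
  · intro h
    obtain ⟨φ, hφ, h⟩ := Quotient.exact h
    have := (inn_diag φ hφ ⟨(0, 0), rfl⟩).2 rfl
    rw [h] at this
    exact absurd this (by decide)
end

section
/- Let f : A → B be a surjective quandle homomorphism. Then the canonical map (η_A, f) : A → π₀(A) ×_{π₀(B)} B, a ↦ ([a], f(a)), is a bijection onto the pullback {(x,b) ∈ π₀(A) × B : π₀(f)(x) = [b]} if and only if Eq(f) ∩ ≈_A = Δ_A, i.e. if and only if for all a, a' ∈ A, f(a) = f(a') together with a ≈_A a' implies a = a'. -/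
/- Conventions: we use Mathlib's `Quandle`, in which the translation by `b` is
`Rack.act' b : a ↦ b ◃ a` (the mirror of the paper's right-action convention
`ρ_b : a ↦ a ◃ b`).  Accordingly, a *trivial* quandle is one with `x ◃ y = y`. -/

open Quandles

theorem inn_lift {A B : Type*} [Quandle A] [Quandle B] (f : A → B)
    (hf : Function.Surjective f) (hhom : IsQndHom f) (ψ : Equiv.Perm B) (hψ : ψ ∈ Inn B) :
    ∃ φ ∈ Inn A, ∀ a, f (φ a) = ψ (f a) := by
  unfold Inn at hψ
  induction hψ using Subgroup.closure_induction with
  | mem x hx =>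
    obtain ⟨b, rfl⟩ := hx
    obtain ⟨c, rfl⟩ := hf b
    exact ⟨Rack.act' c, Subgroup.subset_closure ⟨c, rfl⟩, fun a => hhom c a⟩
  | one => exact ⟨1, one_mem _, fun a => rfl⟩
  | mul x y _ _ hx hy =>
    obtain ⟨φ, h1, h2⟩ := hx
    obtain ⟨χ, h3, h4⟩ := hy
    exact ⟨φ * χ, mul_mem h1 h3, fun a => by simp [h2, h4]⟩
  | inv x _ hx =>
    obtain ⟨φ, h1, h2⟩ := hx
    refine ⟨φ⁻¹, inv_mem h1, fun a => ?_⟩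
    rw [Equiv.Perm.eq_inv_iff_eq, ← h2]
    simp

/-- For a surjective quandle homomorphism `f : A → B`, the canonical map
`(η_A, f) : A → π₀(A) ×_{π₀(B)} B` is a bijection iff `Eq(f) ∩ ≈_A = Δ_A`. -/
theorem stmt9 {A B : Type*} [Quandle A] [Quandle B] (f : A → B)
    (hf : Function.Surjective f) (hhom : IsQndHom f) :
    ∀ F : Quotient (compSetoid A) → Quotient (compSetoid B),
      ∀ hF : ∀ a : A, F (Quotient.mk (compSetoid A) a) = Quotient.mk (compSetoid B) (f a),
      (Function.Bijective (fun a : A =>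
          (⟨(Quotient.mk (compSetoid A) a, f a), hF a⟩ :
            {x : Quotient (compSetoid A) × B // F x.1 = Quotient.mk (compSetoid B) x.2})) ↔
        ∀ a a' : A, f a = f a' → (∃ φ ∈ Inn A, φ a = a') → a = a') := by
  intro F hF
  constructor
  · rintro ⟨hinj, -⟩ a a' h1 h2
    apply hinj
    apply Subtype.ext
    exact Prod.ext (Quotient.sound h2) h1
  · intro h
    constructor
    · intro a a' e
      have e' := congrArg Subtype.val e
      exact h a a' (congrArg Prod.snd e') (Quotient.exact (congrArg Prod.fst e'))
    · rintro ⟨⟨x, b⟩, hx⟩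
      induction x using Quotient.inductionOn with
      | h a =>
      have h1 : Quotient.mk (compSetoid B) (f a) = Quotient.mk (compSetoid B) b :=
        (hF a).symm.trans hx
      obtain ⟨ψ, hψ, h2⟩ := Quotient.exact h1
      obtain ⟨φ, hφ, h3⟩ := inn_lift f hf hhom ψ hψ
      refine ⟨φ a, Subtype.ext (Prod.ext ?_ ((h3 a).trans h2))⟩
      have h4 : Quotient.mk (compSetoid A) a = Quotient.mk (compSetoid A) (φ a) :=
        Quotient.sound ⟨φ, hφ, rfl⟩
      exact h4.symm
end

section
/- Let f : A → B be a surjective quandle homomorphism. Then there exist a quandle C and surjective quandle homomorphisms g : A → C and h : C → B with f = h ∘ g, such that Eq(g) = ∼_{Ker(Inn(g))} and the induced group homomorphism Inn(h) : Inn(C) → Inn(B) is an isomorphism. (Concretely, C can be taken to be the quotient quandle A/∼_{Ker(Inn(f))}.) -/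
/- Conventions: we use Mathlib's `Quandle`, in which the translation by `b` is
`Rack.act' b : a ↦ b ◃ a` (the mirror of the paper's right-action convention
`ρ_b : a ↦ a ◃ b`).  Accordingly, a *trivial* quandle is one with `x ◃ y = y`. -/

open Quandles

universe u v

theorem qnd_inv {A : Type*} {B : Type*} [Quandle A] [Quandle B] {f : A → B}
    (hhom : IsQndHom f) (a a' : A) : f (a ◃⁻¹ a') = f a ◃⁻¹ f a' := by
  rw [← Rack.left_cancel (f a), ← hhom]
  simp

theorem act_mem_Inn {A : Type*} [Quandle A] (a : A) :
    (Rack.act' a : Equiv.Perm A) ∈ Inn A :=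
  Subgroup.subset_closure ⟨a, rfl⟩

theorem exists_innMap {A : Type*} {B : Type*} [Quandle A] [Quandle B] (f : A → B)
    (hf : Function.Surjective f) (hhom : IsQndHom f) :
    ∃ F : ↥(Inn A) →* ↥(Inn B),
      (∀ (φ : ↥(Inn A)) (a : A), (F φ : Equiv.Perm B) (f a) = f ((φ : Equiv.Perm A) a)) ∧
      Function.Surjective F := by
  have key : ∀ φ : ↥(Inn A), ∃ ψ : ↥(Inn B), ∀ a,
      (ψ : Equiv.Perm B) (f a) = f ((φ : Equiv.Perm A) a) := by
    rintro ⟨φ, hφ⟩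
    refine Subgroup.closure_induction (p := fun φ _ => ∃ ψ : ↥(Inn B), ∀ a,
      (ψ : Equiv.Perm B) (f a) = f (φ a)) ?_ ?_ ?_ ?_ hφ
    · rintro _ ⟨b, rfl⟩
      exact ⟨⟨_, act_mem_Inn (f b)⟩, fun a => (hhom b a).symm⟩
    · exact ⟨1, fun a => rfl⟩
    · rintro x y _ _ ⟨p, hp⟩ ⟨q, hq⟩
      exact ⟨p * q, fun a => by simp [hp, hq]⟩
    · rintro x _ ⟨p, hp⟩
      refine ⟨p⁻¹, fun a => ?_⟩
      rw [Subgroup.coe_inv, Equiv.Perm.inv_eq_iff_eq, hp]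
      simp
  have uniq : ∀ p q : ↥(Inn B), (∀ a, (p : Equiv.Perm B) (f a) = (q : Equiv.Perm B) (f a)) →
      p = q := by
    intro p q h
    apply Subtype.ext
    ext b
    obtain ⟨a, rfl⟩ := hf b
    exact h a
  choose F hF using key
  let F' : ↥(Inn A) →* ↥(Inn B) := MonoidHom.mk' F (by
    intro x y
    apply uniq
    intro a
    simp [hF])
  refine ⟨F', hF, ?_⟩
  rintro ⟨ψ, hψ⟩
  suffices h : ∃ x, ((F' x : ↥(Inn B)) : Equiv.Perm B) = ψ by
    obtain ⟨x, hx⟩ := h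
    exact ⟨x, Subtype.ext hx⟩
  refine Subgroup.closure_induction (p := fun ψ _ => ∃ x, ((F' x : ↥(Inn B)) : Equiv.Perm B) = ψ)
    ?_ ?_ ?_ ?_ hψ
  · rintro _ ⟨b, rfl⟩
    obtain ⟨a, rfl⟩ := hf b
    refine ⟨⟨_, act_mem_Inn a⟩, ?_⟩
    ext c
    obtain ⟨a', rfl⟩ := hf c
    exact (hF _ a').trans (hhom a a')
  · exact ⟨1, by simp⟩
  · rintro x y _ _ ⟨p, rfl⟩ ⟨q, rfl⟩
    exact ⟨p * q, by simp⟩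
  · rintro x _ ⟨p, rfl⟩
    exact ⟨p⁻¹, by simp⟩

/-- Orbit relation of the kernel of `Inn f`. -/
def kerSetoid {A : Type*} {B : Type*} [Quandle A] (f : A → B) : Setoid A where
  r a b := ∃ φ ∈ Inn A, (∀ x, f (φ x) = f x) ∧ φ a = b
  iseqv := by
    constructor
    · exact fun a => ⟨1, one_mem _, fun _ => rfl, rfl⟩
    · rintro a b ⟨φ, hφ, h, rfl⟩
      exact ⟨φ⁻¹, inv_mem hφ, fun x => by rw [← h]; simp, by simp⟩
    · rintro a b c ⟨φ, hφ, h, rfl⟩ ⟨ψ, hψ, h', rfl⟩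
      exact ⟨ψ * φ, mul_mem hψ hφ, fun x => by simp [h, h'], by simp⟩

theorem ker_act {A : Type*} {B : Type*} [Quandle A] [Quandle B] {f : A → B}
    (hhom : IsQndHom f) (a b : A) (hab : kerSetoid f a b) (a' b' : A)
    (hab' : kerSetoid f a' b') : kerSetoid f (a ◃ a') (b ◃ b') := by
  obtain ⟨n, hn, h, rfl⟩ := hab
  obtain ⟨m, hm, h', rfl⟩ := hab'
  refine ⟨Rack.act' (n a) * m * (Rack.act' a)⁻¹,
    mul_mem (mul_mem (act_mem_Inn _) hm) (inv_mem (act_mem_Inn _)), fun x => ?_, ?_⟩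
  · simp only [Equiv.Perm.mul_apply, Rack.act'_apply, Rack.invAct_apply, hhom _ _, h, h',
      qnd_inv hhom, Rack.act_invAct_eq]
  · simp only [Equiv.Perm.mul_apply, Rack.act'_apply, Rack.invAct_apply, Rack.invAct_act_eq]

theorem ker_inv {A : Type*} {B : Type*} [Quandle A] [Quandle B] {f : A → B}
    (hhom : IsQndHom f) (a b : A) (hab : kerSetoid f a b) (a' b' : A)
    (hab' : kerSetoid f a' b') : kerSetoid f (a ◃⁻¹ a') (b ◃⁻¹ b') := by
  obtain ⟨n, hn, h, rfl⟩ := hab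
  obtain ⟨m, hm, h', rfl⟩ := hab'
  refine ⟨(Rack.act' (n a))⁻¹ * m * Rack.act' a,
    mul_mem (mul_mem (inv_mem (act_mem_Inn _)) hm) (act_mem_Inn _), fun x => ?_, ?_⟩
  · simp only [Equiv.Perm.mul_apply, Rack.act'_apply, Rack.invAct_apply, hhom _ _, h, h',
      qnd_inv hhom, Rack.invAct_act_eq]
  · simp only [Equiv.Perm.mul_apply, Rack.act'_apply, Rack.invAct_apply, Rack.act_invAct_eq]

/-- The quotient quandle. -/
@[reducible] def kerQuandle {A : Type*} {B : Type*} [Quandle A] [Quandle B] {f : A → B}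
    (hhom : IsQndHom f) : Quandle (Quotient (kerSetoid f)) where
  act := Quotient.map₂ (fun a b => a ◃ b) (ker_act hhom)
  self_distrib := by
    rintro ⟨x⟩ ⟨y⟩ ⟨z⟩
    exact congrArg (Quotient.mk _) Shelf.self_distrib
  invAct := Quotient.map₂ (fun a b => a ◃⁻¹ b) (ker_inv hhom)
  left_inv := by
    rintro ⟨x⟩ ⟨y⟩
    exact congrArg (Quotient.mk _) (Rack.left_inv x y)
  right_inv := by
    rintro ⟨x⟩ ⟨y⟩
    exact congrArg (Quotient.mk _) (Rack.right_inv x y)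
  fix := by
    rintro ⟨x⟩
    exact congrArg (Quotient.mk _) Quandle.fix

/-- Every surjective quandle homomorphism `f : A → B` factors as `f = h ∘ g` with
`Eq(g) = ∼_{Ker(Inn(g))}` and `Inn(h) : Inn(C) → Inn(B)` an isomorphism. -/
theorem stmt12 {A : Type u} {B : Type v} [Quandle A] [Quandle B] (f : A → B)
    (hf : Function.Surjective f) (hhom : IsQndHom f) :
    ∃ (C : Type u) (_ : Quandle C) (g : A → C) (h : C → B),
      IsQndHom g ∧ IsQndHom h ∧ Function.Surjective g ∧ Function.Surjective h ∧
      (∀ a : A, h (g a) = f a) ∧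
      (∃ G : ↥(Inn A) →* ↥(Inn C),
        (∀ (φ : ↥(Inn A)) (a : A), (G φ : Equiv.Perm C) (g a) = g ((φ : Equiv.Perm A) a)) ∧
        ∀ a a' : A, g a = g a' ↔ ∃ n ∈ G.ker, (n : Equiv.Perm A) a = a') ∧
      (∃ H : ↥(Inn C) →* ↥(Inn B),
        (∀ (ψ : ↥(Inn C)) (c : C), (H ψ : Equiv.Perm B) (h c) = h ((ψ : Equiv.Perm C) c)) ∧
        Function.Bijective H) := by
  letI : Quandle (Quotient (kerSetoid f)) := kerQuandle hhom
  let g : A → Quotient (kerSetoid f) := Quotient.mk _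
  let h : Quotient (kerSetoid f) → B := Quotient.lift f (by
    rintro a b ⟨φ, _, h, rfl⟩
    exact (h a).symm)
  have hg : IsQndHom g := fun _ _ => rfl
  have hh : IsQndHom h := by
    rintro ⟨a⟩ ⟨b⟩
    exact hhom a b
  have gs : Function.Surjective g := Quotient.mk_surjective
  have hs : Function.Surjective h := fun b => by
    obtain ⟨a, rfl⟩ := hf b
    exact ⟨g a, rfl⟩
  have hhg : ∀ a, h (g a) = f a := fun _ => rfl
  obtain ⟨G, hG, Gs⟩ := exists_innMap g gs hg
  obtain ⟨H, hH, Hs⟩ := exists_innMap h hs hh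
  have kerG : ∀ n : ↥(Inn A), (∀ x, f ((n : Equiv.Perm A) x) = f x) → G n = 1 := by
    intro n hn
    apply Subtype.ext
    ext c
    obtain ⟨a, rfl⟩ := gs c
    rw [hG]
    exact (Quotient.sound (s := kerSetoid f) ⟨n, n.2, hn, rfl⟩).symm
  refine ⟨Quotient (kerSetoid f), inferInstance, g, h, hg, hh, gs, hs, hhg, ⟨G, hG, ?_⟩,
    ⟨H, hH, ?_, Hs⟩⟩
  · intro a a'
    constructor
    · intro e
      obtain ⟨n, hn, hx, e⟩ := Quotient.exact e
      exact ⟨⟨n, hn⟩, kerG _ hx, e⟩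
    · rintro ⟨n, hn, rfl⟩
      rw [← hG, MonoidHom.mem_ker.1 hn]
      rfl
  · rw [injective_iff_map_eq_one]
    intro ψ hψ
    obtain ⟨φ, rfl⟩ := Gs ψ
    apply kerG
    intro x
    rw [← hhg, ← hG, ← hH, hψ]
    rfl
end

section
/- Let f : A → B, m : C → D, g : A → C and h : B → D be surjective quandle homomorphisms with h ∘ f = m ∘ g. Assume that Eq(f) = ∼_{Ker(Inn(f))} and that the induced group homomorphism Inn(m) : Inn(C) → Inn(D) is an isomorphism. Then there exists a unique quandle homomorphism t : B → C such that t ∘ f = g and m ∘ t = h. (Orthogonality of the classes 𝓔₁ and 𝓜₁.) -/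
/- Conventions: we use Mathlib's `Quandle`, in which the translation by `b` is
`Rack.act' b : a ↦ b ◃ a` (the mirror of the paper's right-action convention
`ρ_b : a ↦ a ◃ b`).  Accordingly, a *trivial* quandle is one with `x ◃ y = y`. -/

open Quandles

theorem inn_lift_aux {A C : Type*} [Quandle A] [Quandle C] (g : A → C) (hgh : IsQndHom g)
    (φ : Equiv.Perm A) (hφ : φ ∈ Inn A) :
    ∃ ψ ∈ Inn C, ∀ a : A, (ψ : Equiv.Perm C) (g a) = g (φ a) := by
  unfold Inn at hφ
  induction hφ using Subgroup.closure_induction with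
  | mem x hx =>
    obtain ⟨b, rfl⟩ := hx
    exact ⟨Rack.act' (g b), Subgroup.subset_closure ⟨g b, rfl⟩, fun a => (hgh b a).symm⟩
  | one => exact ⟨1, one_mem _, fun a => rfl⟩
  | mul x y _ _ hx hy =>
    obtain ⟨p, hp, hp'⟩ := hx
    obtain ⟨q, hq, hq'⟩ := hy
    exact ⟨p * q, mul_mem hp hq, fun a => by
      rw [Equiv.Perm.mul_apply, Equiv.Perm.mul_apply, hq', hp']⟩
  | inv x _ hx =>
    obtain ⟨p, hp, hp'⟩ := hx
    exact ⟨p⁻¹, inv_mem hp, fun a => by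
      rw [Equiv.Perm.inv_eq_iff_eq, hp']; simp⟩

/-- Orthogonality of the classes `𝓔₁` and `𝓜₁`: given a commutative square of surjective
homomorphisms with `Eq(f) = ∼_{Ker(Inn(f))}` and `Inn(m)` an isomorphism, there is a unique
homomorphism `t` with `t ∘ f = g` and `m ∘ t = h`. -/
theorem stmt13 {A B C D : Type*} [Quandle A] [Quandle B] [Quandle C] [Quandle D]
    (f : A → B) (m : C → D) (g : A → C) (h : B → D)
    (hfs : Function.Surjective f) (hms : Function.Surjective m)
    (hgs : Function.Surjective g) (hhs : Function.Surjective h)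
    (hfh : IsQndHom f) (hmh : IsQndHom m) (hgh : IsQndHom g) (hhh : IsQndHom h)
    (hcomm : ∀ a : A, h (f a) = m (g a))
    (F : ↥(Inn A) →* ↥(Inn B))
    (hF : ∀ (φ : ↥(Inn A)) (a : A), (F φ : Equiv.Perm B) (f a) = f ((φ : Equiv.Perm A) a))
    (hEf : ∀ a a' : A, f a = f a' ↔ ∃ n ∈ F.ker, (n : Equiv.Perm A) a = a')
    (M : ↥(Inn C) →* ↥(Inn D))
    (hM : ∀ (ψ : ↥(Inn C)) (c : C), (M ψ : Equiv.Perm D) (m c) = m ((ψ : Equiv.Perm C) c))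
    (hMiso : Function.Bijective M) :
    ∃! t : B → C, IsQndHom t ∧ (∀ a : A, t (f a) = g a) ∧ (∀ b : B, m (t b) = h b) := by
  have key : ∀ a a' : A, f a = f a' → g a = g a' := by
    intro a a' haa
    obtain ⟨n, hn, rfl⟩ := (hEf a a').1 haa
    obtain ⟨ψ, hψ, hψg⟩ := inn_lift_aux g hgh n n.2
    have hM1 : M ⟨ψ, hψ⟩ = 1 := by
      apply Subtype.ext
      apply Equiv.ext
      intro d
      obtain ⟨c, rfl⟩ := hms d
      obtain ⟨x, rfl⟩ := hgs c
      have hfx : f ((n : Equiv.Perm A) x) = f x := ((hEf x _).2 ⟨n, hn, rfl⟩).symm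
      rw [hM]
      change m (ψ (g x)) = m (g x)
      rw [hψg, ← hcomm, hfx, hcomm]
    have h1 : (⟨ψ, hψ⟩ : ↥(Inn C)) = 1 := hMiso.1 (hM1.trans (map_one M).symm)
    have h2 : ψ = 1 := congrArg Subtype.val h1
    rw [← hψg, h2]
    rfl
  have ht : ∀ a : A, g (Function.surjInv hfs (f a)) = g a := fun a =>
    key _ _ (Function.surjInv_eq hfs (f a))
  refine ⟨fun b => g (Function.surjInv hfs b), ⟨?_, ht, ?_⟩, ?_⟩
  · intro b b'
    obtain ⟨a, rfl⟩ := hfs b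
    obtain ⟨a', rfl⟩ := hfs b'
    change g (Function.surjInv hfs (f a ◃ f a')) =
      g (Function.surjInv hfs (f a)) ◃ g (Function.surjInv hfs (f a'))
    rw [← hfh, ht, ht, ht, hgh]
  · intro b
    change m (g (Function.surjInv hfs b)) = h b
    rw [← hcomm, Function.surjInv_eq hfs b]
  · rintro t ⟨_, htf, _⟩
    funext b
    obtain ⟨a, rfl⟩ := hfs b
    exact (htf a).trans (ht a).symm
end

section
/- Let f : A → B be a surjective quandle homomorphism with Eq(f) ∩ ≈_A = Δ_A. Then the induced group homomorphism Inn(f) : Inn(A) → Inn(B) is an isomorphism; that is, the class 𝓜 is contained in the class 𝓜₁. -/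
/- Conventions: we use Mathlib's `Quandle`, in which the translation by `b` is
`Rack.act' b : a ↦ b ◃ a` (the mirror of the paper's right-action convention
`ρ_b : a ↦ a ◃ b`).  Accordingly, a *trivial* quandle is one with `x ◃ y = y`. -/

open Quandles

/-- If `f` is a surjective quandle homomorphism with `Eq(f) ∩ ≈_A = Δ_A`, then the induced
group homomorphism `Inn(f) : Inn(A) → Inn(B)` is an isomorphism (`𝓜 ⊆ 𝓜₁`). -/
theorem stmt15 {A B : Type*} [Quandle A] [Quandle B] (f : A → B)
    (hf : Function.Surjective f) (hhom : IsQndHom f)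
    (hM : ∀ a a' : A, f a = f a' → (∃ φ ∈ Inn A, φ a = a') → a = a')
    (F : ↥(Inn A) →* ↥(Inn B))
    (hF : ∀ (φ : ↥(Inn A)) (a : A), (F φ : Equiv.Perm B) (f a) = f ((φ : Equiv.Perm A) a)) :
    Function.Bijective F := by
  constructor
  · rw [injective_iff_map_eq_one]
    intro φ hφ
    apply Subtype.ext
    apply Equiv.ext
    intro a
    have h := hF φ a
    rw [hφ] at h
    exact (hM a _ h ⟨φ, φ.2, rfl⟩).symm
  · have key : Inn B ≤ ((Inn B).subtype.comp F).range := by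
      refine (Subgroup.closure_le _).2 ?_
      rintro _ ⟨b, rfl⟩
      obtain ⟨a, rfl⟩ := hf b
      refine ⟨⟨Rack.act' a, Subgroup.subset_closure ⟨a, rfl⟩⟩, ?_⟩
      apply Equiv.ext
      intro y
      obtain ⟨x, rfl⟩ := hf y
      exact (hF _ x).trans (hhom a x)
    intro ψ
    obtain ⟨φ, hφ⟩ := key ψ.2
    exact ⟨φ, Subtype.ext hφ⟩
end

section
/- There exist finite quandles A, X, M and surjective quandle homomorphisms g : A → X and f : X → M such that Eq(f) = ∼_{Ker(Inn(f))} and Eq(f ∘ g) = ∼_{Ker(Inn(f ∘ g))}, but Eq(g) ≠ ∼_{Ker(Inn(g))}. Hence the class 𝓔₁ does not satisfy the cancellation property 'f ∘ g ∈ 𝓔₁ and f ∈ 𝓔₁ implies g ∈ 𝓔₁' characteristic of reflective factorisation systems. -/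
/- Conventions: we use Mathlib's `Quandle`, in which the translation by `b` is
`Rack.act' b : a ↦ b ◃ a` (the mirror of the paper's right-action convention
`ρ_b : a ↦ a ◃ b`).  Accordingly, a *trivial* quandle is one with `x ◃ y = y`. -/

open Quandles

/-- Ordered pairs of distinct elements of `Fin 4`. -/
abbrev OPair : Type := {p : Fin 4 × Fin 4 // p.1 ≠ p.2}

/-- The smallest element outside the pair. -/
def OPair.lo (p : OPair) : Fin 4 :=
  if p.1.1 ≠ 0 ∧ p.1.2 ≠ 0 then 0 else if p.1.1 ≠ 1 ∧ p.1.2 ≠ 1 then 1 else 2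

/-- The transposition of the complement of the pair. -/
def OPair.tau (p : OPair) : Equiv.Perm (Fin 4) :=
  Equiv.swap p.lo (2 - p.1.1 - p.1.2 - p.lo)

/-- The action of permutations on pairs. -/
def OPair.mv (s : Equiv.Perm (Fin 4)) (p : OPair) : OPair :=
  ⟨(s p.1.1, s p.1.2), fun h => p.2 (s.injective h)⟩

lemma OPair.tau_mv : ∀ (s : Equiv.Perm (Fin 4)) (p : OPair),
    (OPair.mv s p).tau = s * p.tau * s⁻¹ := by decide +kernel

lemma OPair.tau_fix : ∀ p : OPair, OPair.mv p.tau p = p := by decide +kernel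

lemma OPair.conn : ∀ a a' : OPair, ∃ b c : OPair,
    OPair.mv b.tau (OPair.mv c.tau a) = a' := by decide +kernel

lemma OPair.mv_mul (s t : Equiv.Perm (Fin 4)) (p : OPair) :
    OPair.mv (s * t) p = OPair.mv s (OPair.mv t p) := rfl

lemma OPair.mv_one (p : OPair) : OPair.mv 1 p = p := rfl

/-- The twelve-element quandle. -/
instance OPair.quandle : Quandle OPair where
  act a b := OPair.mv a.tau b
  self_distrib := by
    intro x y z
    rw [OPair.tau_mv, ← OPair.mv_mul, ← OPair.mv_mul]
    simp
  invAct a b := OPair.mv a.tau⁻¹ b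
  left_inv := by
    intro x y
    change OPair.mv _ (OPair.mv _ y) = y
    rw [← OPair.mv_mul, inv_mul_cancel, OPair.mv_one]
  right_inv := by
    intro x y
    change OPair.mv _ (OPair.mv _ y) = y
    rw [← OPair.mv_mul, mul_inv_cancel, OPair.mv_one]
  fix := by
    intro x
    exact OPair.tau_fix x

lemma OPair.act_def (a b : OPair) : a ◃ b = OPair.mv a.tau b := rfl

/-- The quandle of transpositions. -/
abbrev TrX : Type := {s : Equiv.Perm (Fin 4) // ∃ p : OPair, p.tau = s}

/-- Conjugation of transpositions. -/
def TrX.cj (s : Equiv.Perm (Fin 4)) (x : TrX) : TrX :=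
  ⟨s * x.1 * s⁻¹, by
    obtain ⟨p, hp⟩ := x.2
    exact ⟨OPair.mv s p, by rw [OPair.tau_mv, hp]⟩⟩

/-- The six-element quandle. -/
instance TrX.quandle : Quandle TrX where
  act a b := TrX.cj a.1 b
  self_distrib := by
    intro x y z
    apply Subtype.ext
    simp only [TrX.cj]
    group
  invAct a b := TrX.cj a.1⁻¹ b
  left_inv := by
    intro x y
    apply Subtype.ext
    simp only [TrX.cj]
    group
  right_inv := by
    intro x y
    apply Subtype.ext
    simp only [TrX.cj]
    group
  fix := by
    intro x
    apply Subtype.ext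
    simp only [TrX.cj]
    group

/-- The one-point quandle. -/
def unitQuandle : Quandle Unit where
  act _ _ := ()
  self_distrib := rfl
  invAct _ _ := ()
  left_inv _ _ := rfl
  right_inv _ _ := rfl
  fix := rfl

/-- The projection. -/
def OPair.toTr (p : OPair) : TrX := ⟨p.tau, p, rfl⟩

lemma OPair.toTr_hom (a b : OPair) : (a ◃ b).toTr = a.toTr ◃ b.toTr :=
  Subtype.ext (OPair.tau_mv a.tau b)

lemma OPair.toTr_surj : Function.Surjective OPair.toTr := by
  rintro ⟨s, p, rfl⟩
  exact ⟨p, rfl⟩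

lemma OPair.inn_mv (n : Equiv.Perm OPair) (hn : n ∈ Inn OPair) :
    ∃ s : Equiv.Perm (Fin 4), ∀ a, n a = OPair.mv s a := by
  unfold Inn at hn
  induction hn using Subgroup.closure_induction with
  | mem x hx =>
    obtain ⟨b, rfl⟩ := hx
    exact ⟨b.tau, fun a => rfl⟩
  | one => exact ⟨1, fun a => rfl⟩
  | mul x y _ _ hx hy =>
    obtain ⟨s, hs⟩ := hx
    obtain ⟨t, ht⟩ := hy
    exact ⟨s * t, fun a => by rw [Equiv.Perm.mul_apply, ht, hs, OPair.mv_mul]⟩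
  | inv x _ hx =>
    obtain ⟨s, hs⟩ := hx
    refine ⟨s⁻¹, fun a => ?_⟩
    rw [Equiv.Perm.inv_eq_iff_eq, hs, ← OPair.mv_mul, mul_inv_cancel, OPair.mv_one]

lemma OPair.faithful : ∀ s : Equiv.Perm (Fin 4),
    (∀ a : OPair, (OPair.mv s a).tau = a.tau) → s = 1 := by decide +kernel

lemma Inn.act_mem {A : Type*} [Quandle A] (b : A) : (Rack.act' b : Equiv.Perm A) ∈ Inn A :=
  Subgroup.subset_closure ⟨b, rfl⟩

/-- The class `𝓔₁` fails the cancellation property of reflective factorisation systems: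
there are finite quandles and surjective homomorphisms `g : A → X`, `f : X → M` with
`f ∈ 𝓔₁` and `f ∘ g ∈ 𝓔₁` but `g ∉ 𝓔₁`. -/
theorem stmt16 :
    ∃ (A X M : Type) (_ : Quandle A) (_ : Quandle X) (_ : Quandle M)
      (_ : Finite A) (_ : Finite X) (_ : Finite M) (g : A → X) (f : X → M),
      IsQndHom g ∧ IsQndHom f ∧ Function.Surjective g ∧ Function.Surjective f ∧
      (∃ F : ↥(Inn X) →* ↥(Inn M),
        (∀ (φ : ↥(Inn X)) (x : X), (F φ : Equiv.Perm M) (f x) = f ((φ : Equiv.Perm X) x)) ∧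
        ∀ x x' : X, f x = f x' ↔ ∃ n ∈ F.ker, (n : Equiv.Perm X) x = x') ∧
      (∃ Fg : ↥(Inn A) →* ↥(Inn M),
        (∀ (φ : ↥(Inn A)) (a : A),
            (Fg φ : Equiv.Perm M) (f (g a)) = f (g ((φ : Equiv.Perm A) a))) ∧
        ∀ a a' : A, f (g a) = f (g a') ↔ ∃ n ∈ Fg.ker, (n : Equiv.Perm A) a = a') ∧
      (∀ G : ↥(Inn A) →* ↥(Inn X),
        (∀ (φ : ↥(Inn A)) (a : A), (G φ : Equiv.Perm X) (g a) = g ((φ : Equiv.Perm A) a)) →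
        ¬ ∀ a a' : A, g a = g a' ↔ ∃ n ∈ G.ker, (n : Equiv.Perm A) a = a') := by
  letI := unitQuandle
  refine ⟨OPair, TrX, Unit, inferInstance, inferInstance, unitQuandle, inferInstance,
    inferInstance, inferInstance, OPair.toTr, fun _ => (), OPair.toTr_hom, fun _ _ => rfl,
    OPair.toTr_surj, fun _ => ⟨OPair.toTr ⟨(0, 1), by decide⟩, rfl⟩, ⟨1, fun _ _ => rfl, ?_⟩,
    ⟨1, fun _ _ => rfl, ?_⟩, ?_⟩
  · intro x x'
    refine ⟨fun _ => ?_, fun _ => rfl⟩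
    obtain ⟨a, rfl⟩ := OPair.toTr_surj x
    obtain ⟨a', rfl⟩ := OPair.toTr_surj x'
    obtain ⟨b, c, h⟩ := OPair.conn a a'
    refine ⟨⟨Rack.act' b.toTr * Rack.act' c.toTr,
      mul_mem (Inn.act_mem _) (Inn.act_mem _)⟩, rfl, ?_⟩
    change b.toTr ◃ (c.toTr ◃ a.toTr) = _
    rw [← OPair.toTr_hom, ← OPair.toTr_hom]
    exact congrArg _ h
  · intro a a'
    refine ⟨fun _ => ?_, fun _ => rfl⟩
    obtain ⟨b, c, h⟩ := OPair.conn a a'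
    exact ⟨⟨Rack.act' b * Rack.act' c,
      mul_mem (Inn.act_mem _) (Inn.act_mem _)⟩, rfl, h⟩
  · intro G hG h
    obtain ⟨n, hn, hna⟩ := (h ⟨(0, 1), by decide⟩ ⟨(1, 0), by decide⟩).1
      (Subtype.ext (by decide +kernel))
    obtain ⟨s, hs⟩ := OPair.inn_mv n.1 n.2
    have h1 : s = 1 := by
      apply OPair.faithful
      intro a
      have h2 := hG n a
      rw [MonoidHom.mem_ker.1 hn, hs] at h2
      exact (congrArg Subtype.val h2).symm
    rw [hs, h1] at hna
    exact absurd hna (by decide)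
end
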